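/- Let α = (α0,α1,α2,α3,α4) ∈ ℂ^5 satisfy α0+α1+2α2+α3+α4 = 1, let J ⊆ ℝ∖{0,1} be an open interval, and let q,p : J → ℂ be differentiable with p(t) ≠ 0 for all t ∈ J, satisfying q'(t) = ∂G/∂p(q(t),p(t),t;α) and p'(t) = −∂G/∂q(q(t),p(t),t;α). Let J' = {1−t : t ∈ J} (so J' ⊆ ℝ∖{0,1}), and define on J' the functions q̃(s) = −(q(1−s) + (α3−α4)/p(1−s) + 1/p(1−s)²) and p̃(s) = −p(1−s), and put α̃ = (α0, α1, α2, α4, α3). Then q̃'(s) = ∂G/∂p(q̃(s),p̃(s),s;α̃) and p̃'(s) = −∂G/∂q(q̃(s),p̃(s),s;α̃) for all s ∈ J'; that is, w3 is a Bäcklund transformation of the G-system. -/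

import Mathlib

/-- The polynomial Hamiltonian `G(q,p,t;α)` equivalent to the Painlevé VI
Hamiltonian, characterized by holomorphy conditions. -/
noncomputable def hamG (a0 a1 a2 a3 a4 q p t : ℂ) : ℂ :=
  -(q^3 * p^4) / (t * (t - 1))
  - (a0 + a3 - 2*a4 - 1) * q^2 * p^3 / (t * (t - 1))
  - (t + 1) * q^2 * p^2 / (t * (t - 1))
  - (a1*a2 + a2^2 + 2*a4 - 2*a0*a4 - 2*a3*a4 + a4^2) * q * p^2 / (t * (t - 1))
  - ((a3 - a4) * t + a0 - a4 - 1) * q * p / (t * (t - 1))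
  - q / (t - 1)
  + a4 * (a2 + a4) * (a1 + a2 + a4) * p / (t * (t - 1))

/-- The partial derivative `∂G/∂p`. -/
noncomputable def hamGp (a0 a1 a2 a3 a4 q p t : ℂ) : ℂ :=
  deriv (fun x => hamG a0 a1 a2 a3 a4 q x t) p

/-- The partial derivative `∂G/∂q`. -/
noncomputable def hamGq (a0 a1 a2 a3 a4 q p t : ℂ) : ℂ :=
  deriv (fun x => hamG a0 a1 a2 a3 a4 x p t) q

lemma hamGp_eq (a0 a1 a2 a3 a4 q p t : ℂ) : hamGp a0 a1 a2 a3 a4 q p t =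
    (-4*q^3*p^3 - 3*(a0 + a3 - 2*a4 - 1)*q^2*p^2 - 2*(t+1)*q^2*p
      - 2*(a1*a2 + a2^2 + 2*a4 - 2*a0*a4 - 2*a3*a4 + a4^2)*q*p
      - ((a3 - a4)*t + a0 - a4 - 1)*q + a4*(a2 + a4)*(a1 + a2 + a4)) * (t*(t-1))⁻¹ := by
  have h1 : HasDerivAt (fun x : ℂ => x) 1 p := hasDerivAt_id p
  have h2 : HasDerivAt (fun x : ℂ => x^2) (2*p) p := by simpa using hasDerivAt_pow 2 p
  have h3 : HasDerivAt (fun x : ℂ => x^3) (3*p^2) p := by simpa using hasDerivAt_pow 3 p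
  have h4 : HasDerivAt (fun x : ℂ => x^4) (4*p^3) p := by simpa using hasDerivAt_pow 4 p
  unfold hamGp hamG
  apply HasDerivAt.deriv
  have := (((((((h4.const_mul (q^3)).neg.div_const (t*(t-1))).sub
    ((h3.const_mul ((a0 + a3 - 2*a4 - 1)*q^2)).div_const (t*(t-1)))).sub
    ((h2.const_mul ((t+1)*q^2)).div_const (t*(t-1)))).sub
    ((h2.const_mul ((a1*a2 + a2^2 + 2*a4 - 2*a0*a4 - 2*a3*a4 + a4^2)*q)).div_const (t*(t-1)))).sub
    ((h1.const_mul (((a3 - a4)*t + a0 - a4 - 1)*q)).div_const (t*(t-1)))).sub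
    (hasDerivAt_const p (q/(t-1)))).add
    ((h1.const_mul (a4*(a2 + a4)*(a1 + a2 + a4))).div_const (t*(t-1)))
  refine this.congr_deriv ?_
  simp only [div_eq_mul_inv]
  ring

lemma hamGq_eq (a0 a1 a2 a3 a4 q p t : ℂ) : hamGq a0 a1 a2 a3 a4 q p t =
    (-3*q^2*p^4 - 2*(a0 + a3 - 2*a4 - 1)*q*p^3 - 2*(t+1)*q*p^2
      - (a1*a2 + a2^2 + 2*a4 - 2*a0*a4 - 2*a3*a4 + a4^2)*p^2
      - ((a3 - a4)*t + a0 - a4 - 1)*p) * (t*(t-1))⁻¹ - (t-1)⁻¹ := by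
  have h1 : HasDerivAt (fun x : ℂ => x) 1 q := hasDerivAt_id q
  have h2 : HasDerivAt (fun x : ℂ => x^2) (2*q) q := by simpa using hasDerivAt_pow 2 q
  have h3 : HasDerivAt (fun x : ℂ => x^3) (3*q^2) q := by simpa using hasDerivAt_pow 3 q
  unfold hamGq hamG
  apply HasDerivAt.deriv
  have := (((((((h3.mul_const (p^4)).neg.div_const (t*(t-1))).sub
    (((h2.const_mul (a0 + a3 - 2*a4 - 1)).mul_const (p^3)).div_const (t*(t-1)))).sub
    (((h2.const_mul (t+1)).mul_const (p^2)).div_const (t*(t-1)))).sub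
    (((h1.const_mul (a1*a2 + a2^2 + 2*a4 - 2*a0*a4 - 2*a3*a4 + a4^2)).mul_const
      (p^2)).div_const (t*(t-1)))).sub
    (((h1.const_mul ((a3 - a4)*t + a0 - a4 - 1)).mul_const p).div_const (t*(t-1)))).sub
    (h1.div_const (t-1))).add
    (hasDerivAt_const q (a4*(a2 + a4)*(a1 + a2 + a4)*p/(t*(t-1))))
  refine this.congr_deriv ?_
  simp only [div_eq_mul_inv]
  ring

/-- `w₃ : (q,p,t;α) ↦ (-(q + (α₃-α₄)/p + 1/p²), -p, 1-t; α₀, α₁, α₂, α₄, α₃)`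
is a Bäcklund transformation of the `G`-system. -/
theorem statement17 (a0 a1 a2 a3 a4 : ℂ)
    (hα : a0 + a1 + 2*a2 + a3 + a4 = 1)
    (aa bb : ℝ) (hJ : Set.Ioo aa bb ⊆ {t : ℝ | t ≠ 0 ∧ t ≠ 1})
    (q p : ℝ → ℂ) (hp0 : ∀ t ∈ Set.Ioo aa bb, p t ≠ 0)
    (hq : ∀ t ∈ Set.Ioo aa bb,
      HasDerivAt q (hamGp a0 a1 a2 a3 a4 (q t) (p t) (t : ℂ)) t)
    (hp : ∀ t ∈ Set.Ioo aa bb,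
      HasDerivAt p (-(hamGq a0 a1 a2 a3 a4 (q t) (p t) (t : ℂ))) t) :
    ∀ s ∈ (fun t : ℝ => 1 - t) '' Set.Ioo aa bb,
      HasDerivAt (fun s : ℝ =>
          -(q (1 - s) + (a3 - a4) / p (1 - s) + 1 / (p (1 - s))^2))
        (hamGp a0 a1 a2 a4 a3
          (-(q (1 - s) + (a3 - a4) / p (1 - s) + 1 / (p (1 - s))^2))
          (-p (1 - s)) (s : ℂ)) s ∧
      HasDerivAt (fun s : ℝ => -p (1 - s))
        (-(hamGq a0 a1 a2 a4 a3
          (-(q (1 - s) + (a3 - a4) / p (1 - s) + 1 / (p (1 - s))^2))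
          (-p (1 - s)) (s : ℂ))) s := by
  rintro s ⟨t, ht, rfl⟩
  obtain ⟨ht0, ht1⟩ := hJ ht
  have e : (1:ℝ) - (1 - t) = t := by ring
  have hpt := hp0 t ht
  have hlin : HasDerivAt (fun s : ℝ => 1 - s) (-1) (1 - t) := by
    simpa using (hasDerivAt_id (1 - t)).const_sub 1
  have hq' := hq t ht
  have hp' := hp t ht
  have ha : a0 = 1 - a1 - 2*a2 - a3 - a4 := by linear_combination hα
  have hT0 : (t:ℂ) ≠ 0 := by exact_mod_cast ht0
  have hT1 : (t:ℂ) - 1 ≠ 0 := sub_ne_zero.mpr (by exact_mod_cast ht1)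
  have i1 : ((1 - (t:ℂ)) * (1 - (t:ℂ) - 1))⁻¹ = ((t:ℂ) * (t - 1))⁻¹ := by congr 1; ring
  have i2 : ((1 - (t:ℂ)) - 1)⁻¹ = - (t - 1) * ((t:ℂ) * (t - 1))⁻¹ := by
    have : (1 - (t:ℂ)) - 1 = -t := by ring
    rw [this]; field_simp
  have i3 : ((t:ℂ) - 1)⁻¹ = t * ((t:ℂ) * (t - 1))⁻¹ := by field_simp
  rw [hamGp_eq] at hq'
  rw [hamGq_eq, i3] at hp'
  have hqc : HasDerivAt (fun s : ℝ => q (1 - s)) _ (1 - t) :=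
    HasDerivAt.scomp (1 - t) (by rw [e]; exact hq') hlin
  have hpc : HasDerivAt (fun s : ℝ => p (1 - s)) _ (1 - t) :=
    HasDerivAt.scomp (1 - t) (by rw [e]; exact hp') hlin
  have hne : p (1 - (1 - t)) ≠ 0 := by rw [e]; exact hpt
  simp only [hamGp_eq, hamGq_eq]
  push_cast
  rw [i1, i2]
  constructor
  · have := ((hqc.add ((hasDerivAt_const (1 - t) (a3 - a4)).div hpc hne)).add
      ((hasDerivAt_const (1 - t) (1:ℂ)).div (hpc.pow 2) (pow_ne_zero 2 hne))).neg
    refine this.congr_deriv ?_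
    simp only [e, Pi.pow_apply]
    generalize ((t:ℂ) * (t - 1))⁻¹ = c
    generalize p t = P at *
    generalize q t = Q at *
    generalize (t:ℂ) = T at *
    subst ha
    simp
    field_simp
    ring
  · refine hpc.neg.congr_deriv ?_
    simp only [e]
    generalize ((t:ℂ) * (t - 1))⁻¹ = c
    generalize p t = P at *
    generalize q t = Q at *
    generalize (t:ℂ) = T at *
    subst ha
    simp
    field_simp
    ring
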